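/- arXiv:2201.06970 — 2 statements merged into one kernel-verified Lean document; each statement's English description precedes it below -/
import Mathlib

section
/- For every integer k ≥ 1 and every real x > 1, the function t ↦ t^{x+k} · (d/dt)^k [1/(e^t − 1)] tends to 0 both as t → 0⁺ and as t → ∞. -/
open Filter

lemma hasDerivAt_one_div_exp_sub_one {t : ℝ} (ht : 0 < t) :
    HasDerivAt (fun s : ℝ => 1 / (Real.exp s - 1))
      (-(1 / (Real.exp t - 1) + (1 / (Real.exp t - 1)) ^ 2)) t := by
  have h : Real.exp t - 1 ≠ 0 := (sub_pos.2 (Real.one_lt_exp_iff.2 ht)).ne'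
  have h1 := ((Real.hasDerivAt_exp t).sub_const 1).inv h
  simp only [one_div]
  refine h1.congr_deriv ?_
  field_simp
  ring

/-- The `k`-th derivative of `u = 1 / (e ^ t - 1)` is `u` times a polynomial in `u` of degree at
most `k`. -/
lemma exists_iteratedDeriv_one_div_exp_sub_one_eq (k : ℕ) :
    ∃ Q : Polynomial ℝ, Q.natDegree ≤ k ∧ ∀ t : ℝ, 0 < t →
      iteratedDeriv k (fun s => 1 / (Real.exp s - 1)) t =
        1 / (Real.exp t - 1) * Q.eval (1 / (Real.exp t - 1)) := by
  induction k with
  | zero => exact ⟨1, by simp, fun t _ => by simp⟩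
  | succ k ih =>
    obtain ⟨Q, hQ, h⟩ := ih
    refine ⟨-((1 + Polynomial.X) * (Q + Polynomial.X * Polynomial.derivative Q)), ?_, ?_⟩
    · have hd : (Polynomial.X * Polynomial.derivative Q).natDegree ≤ k := by
        rcases Nat.eq_zero_or_pos Q.natDegree with h0 | h0
        · rw [Polynomial.derivative_of_natDegree_zero h0]
          simp
        · have h1 := Polynomial.natDegree_derivative_lt h0.ne'
          have h2 := Polynomial.natDegree_mul_le (p := (Polynomial.X : Polynomial ℝ))
            (q := Polynomial.derivative Q)
          rw [Polynomial.natDegree_X] at h2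
          omega
      rw [Polynomial.natDegree_neg, add_comm k 1]
      refine Polynomial.natDegree_mul_le_of_le ?_ (Polynomial.natDegree_add_le_of_degree_le hQ hd)
      exact Polynomial.natDegree_add_le_of_degree_le (by simp) Polynomial.natDegree_X_le
    · intro t ht
      have he : iteratedDeriv k (fun s => 1 / (Real.exp s - 1)) =ᶠ[nhds t]
          fun s => 1 / (Real.exp s - 1) * Q.eval (1 / (Real.exp s - 1)) := by
        filter_upwards [lt_mem_nhds ht] with s hs using h s hs
      have hu := hasDerivAt_one_div_exp_sub_one ht
      have hq := (Q.hasDerivAt (1 / (Real.exp t - 1))).comp t hu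
      rw [iteratedDeriv_succ, he.deriv_eq]
      refine (hu.mul hq).deriv.trans ?_
      simp only [Function.comp_apply, Polynomial.eval_neg, Polynomial.eval_mul,
        Polynomial.eval_add, Polynomial.eval_one, Polynomial.eval_X]
      ring

lemma tendsto_rpow_mul_one_div_exp_sub_one_pow_nhdsGT_zero {a : ℝ} {n : ℕ} (h : n < a) :
    Tendsto (fun t : ℝ => t ^ a * (1 / (Real.exp t - 1)) ^ n)
      (nhdsWithin 0 (Set.Ioi 0)) (nhds 0) := by
  have hlim : Tendsto (fun t : ℝ => t ^ (a - n)) (nhdsWithin 0 (Set.Ioi 0)) (nhds 0) := by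
    have hc := (Real.continuousAt_rpow_const 0 (a - n) (Or.inr (sub_pos.2 h).le)).tendsto
    rw [Real.zero_rpow (sub_pos.2 h).ne'] at hc
    exact hc.mono_left nhdsWithin_le_nhds
  refine tendsto_of_tendsto_of_tendsto_of_le_of_le' tendsto_const_nhds hlim ?_ ?_
  · filter_upwards [self_mem_nhdsWithin] with t (ht : 0 < t)
    have := sub_pos.2 (Real.one_lt_exp_iff.2 ht)
    positivity
  · filter_upwards [self_mem_nhdsWithin] with t (ht : 0 < t)
    have := sub_pos.2 (Real.one_lt_exp_iff.2 ht)
    rw [Real.rpow_sub ht, Real.rpow_natCast, div_eq_mul_one_div (t ^ a), ← one_div_pow]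
    gcongr
    linarith [Real.add_one_le_exp t]

lemma tendsto_rpow_mul_one_div_exp_sub_one_pow_atTop (a : ℝ) {n : ℕ} (hn : n ≠ 0) :
    Tendsto (fun t : ℝ => t ^ a * (1 / (Real.exp t - 1)) ^ n) atTop (nhds 0) := by
  have hlim := (tendsto_rpow_mul_exp_neg_mul_atTop_nhds_zero a 1 one_pos).mul_const 2
  rw [zero_mul] at hlim
  refine tendsto_of_tendsto_of_tendsto_of_le_of_le' tendsto_const_nhds hlim ?_ ?_
  · filter_upwards [eventually_gt_atTop 0] with t ht
    have := sub_pos.2 (Real.one_lt_exp_iff.2 ht)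
    positivity
  · filter_upwards [eventually_ge_atTop 1] with t ht
    have he : 2 ≤ Real.exp t := by linarith [Real.add_one_le_exp t]
    have hpos : 0 < Real.exp t - 1 := by linarith
    have hle : 1 / (Real.exp t - 1) ≤ 1 := (div_le_one hpos).2 (by linarith)
    have hle_exp : 1 / (Real.exp t - 1) ≤ Real.exp (-1 * t) * 2 := by
      rw [neg_one_mul, Real.exp_neg, div_le_iff₀ hpos]
      field_simp
      linarith
    rw [mul_assoc]
    gcongr
    exact (pow_le_of_le_one (by positivity) hle hn).trans hle_exp

/-- For every integer `k ≥ 1` and every real `x > 1`, the function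
`t ↦ t^{x+k} · (d/dt)^k [1/(e^t − 1)]` tends to `0` as `t → 0⁺` and as `t → ∞`. -/
theorem rpow_mul_iteratedDeriv_tendsto_zero (k : ℕ) (hk : 1 ≤ k) (x : ℝ) (hx : 1 < x) :
    Tendsto (fun t : ℝ => t ^ (x + k) * iteratedDeriv k (fun s => 1 / (Real.exp s - 1)) t)
        (nhdsWithin 0 (Set.Ioi 0)) (nhds 0) ∧
      Tendsto (fun t : ℝ => t ^ (x + k) * iteratedDeriv k (fun s => 1 / (Real.exp s - 1)) t)
        atTop (nhds 0) := by
  obtain ⟨Q, hQ, h⟩ := exists_iteratedDeriv_one_div_exp_sub_one_eq k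
  have key : ∀ l : Filter ℝ, (∀ᶠ t in l, 0 < t) →
      (∀ j ≤ k, Tendsto (fun t : ℝ => t ^ (x + k) * (1 / (Real.exp t - 1)) ^ (j + 1)) l
        (nhds 0)) →
      Tendsto (fun t : ℝ => t ^ (x + k) * iteratedDeriv k (fun s => 1 / (Real.exp s - 1)) t) l
        (nhds 0) := by
    intro l hl hj
    have hs : Tendsto (fun t : ℝ => ∑ j ∈ Finset.range (k + 1),
        Q.coeff j * (t ^ (x + k) * (1 / (Real.exp t - 1)) ^ (j + 1))) l (nhds 0) := by
      simpa using tendsto_finsetSum (Finset.range (k + 1)) fun j hmem =>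
        (hj j (Nat.lt_succ_iff.1 (Finset.mem_range.1 hmem))).const_mul (Q.coeff j)
    refine hs.congr' ?_
    filter_upwards [hl] with t ht
    rw [h t ht, Polynomial.eval_eq_sum_range' (Nat.lt_succ_of_le hQ), Finset.mul_sum,
      Finset.mul_sum]
    exact Finset.sum_congr rfl fun j _ => by ring
  refine ⟨key _ self_mem_nhdsWithin fun j hj => ?_, key _ (eventually_gt_atTop 0) fun j _ => ?_⟩
  · refine tendsto_rpow_mul_one_div_exp_sub_one_pow_nhdsGT_zero ?_
    have : (j : ℝ) ≤ k := Nat.cast_le.2 hj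
    push_cast
    linarith
  · exact tendsto_rpow_mul_one_div_exp_sub_one_pow_atTop _ j.succ_ne_zero
end

section
/- For every integer k ≥ 0, the ratio 𝔉_k(t) = F_{k+1}(t)/F_k(t) is decreasing in t on (0, ∞), where F_k(t) = (−1)^k · (d/dt)^k [1/(e^t − 1)]. -/
/-- `F_k(t) = (−1)^k · (d/dt)^k [1/(e^t − 1)]`. -/
noncomputable def F (k : ℕ) (t : ℝ) : ℝ :=
  (-1) ^ k * iteratedDeriv k (fun s => 1 / (Real.exp s - 1)) t

theorem summable_succ_pow_mul_exp_neg (k : ℕ) {t : ℝ} (ht : 0 < t) :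
    Summable fun n : ℕ => ((n : ℝ) + 1) ^ k * Real.exp (-(((n : ℝ) + 1) * t)) := by
  have h := (summable_nat_add_iff 1).2 (Real.summable_pow_mul_exp_neg_nat_mul k ht)
  refine h.congr fun n => ?_
  push_cast
  ring_nf

theorem tsum_exp_neg_succ_mul {t : ℝ} (ht : 0 < t) :
    ∑' n : ℕ, Real.exp (-(((n : ℝ) + 1) * t)) = 1 / (Real.exp t - 1) := by
  have h1 : Real.exp (-t) < 1 := by simpa using ht
  have h := (hasSum_geometric_of_lt_one (Real.exp_pos (-t)).le h1).mul_left (Real.exp (-t))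
  have hterm : ∀ n : ℕ, Real.exp (-(((n : ℝ) + 1) * t)) = Real.exp (-t) * Real.exp (-t) ^ n := by
    intro n
    rw [← Real.exp_nat_mul, ← Real.exp_add]
    ring_nf
  simp_rw [hterm]
  rw [h.tsum_eq, Real.exp_neg]
  have h2 : 1 < Real.exp t := by simpa using ht
  have h3 : Real.exp t - 1 ≠ 0 := by linarith
  field_simp

theorem hasDerivAt_tsum_succ_pow_mul_exp_neg (k : ℕ) {t : ℝ} (ht : 0 < t) :
    HasDerivAt (fun s => ∑' n : ℕ, ((n : ℝ) + 1) ^ k * Real.exp (-(((n : ℝ) + 1) * s)))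
      (-∑' n : ℕ, ((n : ℝ) + 1) ^ (k + 1) * Real.exp (-(((n : ℝ) + 1) * t))) t := by
  rw [← tsum_neg]
  have hmem : t ∈ Set.Ioi (t / 2) := Set.mem_Ioi.2 (by linarith)
  refine hasDerivAt_tsum_of_isPreconnected
    (g' := fun (n : ℕ) (s : ℝ) => -(((n : ℝ) + 1) ^ (k + 1) * Real.exp (-(((n : ℝ) + 1) * s))))
    (summable_succ_pow_mul_exp_neg (k + 1) (half_pos ht)) isOpen_Ioi isPreconnected_Ioi
    (fun n s _ => ?_) (fun n s hs => ?_) hmem (summable_succ_pow_mul_exp_neg k ht) hmem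
  · have h := ((((hasDerivAt_id s).const_mul ((n : ℝ) + 1)).neg).exp).const_mul (((n : ℝ) + 1) ^ k)
    refine h.congr_deriv ?_
    simp only [id, Pi.neg_apply]
    ring
  · have hs' : t / 2 ≤ s := le_of_lt hs
    rw [norm_neg, Real.norm_of_nonneg (by positivity)]
    gcongr

theorem F_eq_tsum (k : ℕ) {t : ℝ} (ht : 0 < t) :
    F k t = ∑' n : ℕ, ((n : ℝ) + 1) ^ k * Real.exp (-(((n : ℝ) + 1) * t)) := by
  have key : ∀ k : ℕ, ∀ s : ℝ, 0 < s → iteratedDeriv k (fun s => 1 / (Real.exp s - 1)) s =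
      (-1) ^ k * ∑' n : ℕ, ((n : ℝ) + 1) ^ k * Real.exp (-(((n : ℝ) + 1) * s)) := by
    intro k
    induction k with
    | zero =>
      intro s hs
      simp [tsum_exp_neg_succ_mul hs]
    | succ k ih =>
      intro s hs
      have heq : iteratedDeriv k (fun s => 1 / (Real.exp s - 1)) =ᶠ[nhds s] fun s =>
          (-1) ^ k * ∑' n : ℕ, ((n : ℝ) + 1) ^ k * Real.exp (-(((n : ℝ) + 1) * s)) :=
        Filter.eventually_of_mem (Ioi_mem_nhds hs) ih
      rw [iteratedDeriv_succ, heq.deriv_eq,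
        ((hasDerivAt_tsum_succ_pow_mul_exp_neg k hs).const_mul ((-1) ^ k)).deriv]
      ring
  rw [F, key k t ht, ← mul_assoc, ← mul_pow]
  simp

theorem F_pos (k : ℕ) {t : ℝ} (ht : 0 < t) : 0 < F k t := by
  rw [F_eq_tsum k ht]
  exact (summable_succ_pow_mul_exp_neg k ht).tsum_pos (fun n => by positivity) 0 (by positivity)

/-- For every integer `k ≥ 0`, the ratio `𝔉_k(t) = F_{k+1}(t)/F_k(t)` is decreasing
in `t` on `(0, ∞)`. -/
theorem F_ratio_strictAntiOn (k : ℕ) :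
    StrictAntiOn (fun t => F (k + 1) t / F k t) (Set.Ioi 0) := by
  intro s hs t ht hst
  rw [Set.mem_Ioi] at hs ht
  have hpos := F_pos k ht
  set c := F (k + 1) t / F k t with hc
  have hsum : ∀ r : ℝ, 0 < r → HasSum
      (fun n : ℕ => ((n : ℝ) + 1) ^ k * ((n : ℝ) + 1 - c) * Real.exp (-(((n : ℝ) + 1) * r)))
      (F (k + 1) r - c * F k r) := by
    intro r hr
    rw [F_eq_tsum _ hr, F_eq_tsum _ hr]
    refine ((summable_succ_pow_mul_exp_neg (k + 1) hr).hasSum.sub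
      ((summable_succ_pow_mul_exp_neg k hr).hasSum.mul_left c)).congr_fun ?_
    intro n
    ring
  have hzero : F (k + 1) t - c * F k t = 0 := by
    rw [hc]
    field_simp
    ring
  have hT := (hsum t ht).mul_left (Real.exp (c * (t - s)))
  rw [hzero, mul_zero] at hT
  have hexp : ∀ x : ℝ, Real.exp (-(x * s)) = Real.exp (x * (t - s)) * Real.exp (-(x * t)) := by
    intro x
    rw [← Real.exp_add]
    ring_nf
  have hlt : ∀ x : ℝ, 0 < x → x ≠ c → Real.exp (c * (t - s)) *
      (x ^ k * (x - c) * Real.exp (-(x * t))) < x ^ k * (x - c) * Real.exp (-(x * s)) := by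
    intro x hx hxc
    have hprod : 0 < (x - c) * (Real.exp (x * (t - s)) - Real.exp (c * (t - s))) := by
      rcases lt_or_gt_of_ne hxc with h | h
      · refine mul_pos_of_neg_of_neg (sub_neg.2 h) (sub_neg.2 (Real.exp_lt_exp.2 ?_))
        exact mul_lt_mul_of_pos_right h (sub_pos.2 hst)
      · refine mul_pos (sub_pos.2 h) (sub_pos.2 (Real.exp_lt_exp.2 ?_))
        exact mul_lt_mul_of_pos_right h (sub_pos.2 hst)
    have := mul_pos (mul_pos (pow_pos hx k) (Real.exp_pos (-(x * t)))) hprod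
    rw [hexp x]
    linarith
  have hle : ∀ n : ℕ, Real.exp (c * (t - s)) * (((n : ℝ) + 1) ^ k * ((n : ℝ) + 1 - c) *
      Real.exp (-(((n : ℝ) + 1) * t))) ≤
      ((n : ℝ) + 1) ^ k * ((n : ℝ) + 1 - c) * Real.exp (-(((n : ℝ) + 1) * s)) := by
    intro n
    by_cases h : (n : ℝ) + 1 = c
    · simp [h]
    · exact (hlt _ (by positivity) h).le
  obtain ⟨m, hm⟩ : ∃ m : ℕ, (m : ℝ) + 1 ≠ c := by
    by_contra! h
    have h0 := h 0
    have h1 := h 1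
    norm_num at h0 h1
    linarith
  have hfin := hasSum_lt hle (hlt _ (by positivity) hm) hT (hsum s hs)
  change c < F (k + 1) s / F k s
  rw [lt_div_iff₀ (F_pos k hs)]
  linarith
end
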